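/- arXiv:2409.02557 — 2 statements merged into one kernel-verified Lean document; each statement's English description precedes it below -/
import Mathlib

section
/- Let N be a positive integer and regard N-th order three-dimensional complex matrices as families A = (A_{ijk}) with i,j,k ∈ {1,…,N}. The trilinear ternary product defined by (A⊙B⊙C)_{ijk} = Σ_{l,m,n} A_{ilm} B_{nml} C_{njk} is associative of the second kind: (A⊙B⊙C)⊙D⊙F = A⊙(D⊙C⊙B)⊙F = A⊙B⊙(C⊙D⊙F) for all three-dimensional matrices A, B, C, D, F of order N. -/
open Finset

/-- Ternary product number 2 (in the sense of Abramov–Kerner–Liivapuu–Shitov) of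
three-dimensional complex matrices of order `N`:
`(A ⊙ B ⊙ C)_{ijk} = A i l m * B n m l * C n j k` (summation over `l, m, n`). -/
noncomputable def tprod3 {N : ℕ} (A B C : Fin N → Fin N → Fin N → ℂ) :
    Fin N → Fin N → Fin N → ℂ :=
  fun i j k => ∑ l, ∑ m, ∑ n, A i l m * B n m l * C n j k

/-- The matrix of contractions `(a, b) ↦ ∑ l m, A a l m * B b m l`. -/
noncomputable def contraction {N : ℕ} (A B : Fin N → Fin N → Fin N → ℂ) :
    Matrix (Fin N) (Fin N) ℂ :=
  fun a b => ∑ l, ∑ m, A a l m * B b m l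

lemma contraction_transpose {N : ℕ} (A B : Fin N → Fin N → Fin N → ℂ) :
    (contraction A B).transpose = contraction B A := by
  ext a b
  simp only [Matrix.transpose_apply, contraction]
  rw [Finset.sum_comm]
  simp only [mul_comm]

lemma tprod3_apply {N : ℕ} (A B C : Fin N → Fin N → Fin N → ℂ) (i j k : Fin N) :
    tprod3 A B C i j k = ∑ n, contraction A B i n * C n j k := by
  simp only [tprod3, contraction, Finset.sum_mul]
  exact sum_comm_cycle

lemma contraction_tprod3_left {N : ℕ} (A B C D : Fin N → Fin N → Fin N → ℂ) :
    contraction (tprod3 A B C) D = contraction A B * contraction C D := by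
  ext a b
  rw [Matrix.mul_apply, contraction]
  simp only [tprod3_apply, Finset.sum_mul]
  rw [Finset.sum_comm_cycle]
  simp only [contraction, Finset.mul_sum, mul_assoc]

lemma contraction_tprod3_right {N : ℕ} (A B C D : Fin N → Fin N → Fin N → ℂ) :
    contraction A (tprod3 D C B) = contraction A B * contraction C D := by
  rw [← contraction_transpose, contraction_tprod3_left, Matrix.transpose_mul,
    contraction_transpose, contraction_transpose]

lemma tprod3_eq_of_contraction_eq {N : ℕ} {A B A' B' : Fin N → Fin N → Fin N → ℂ}
    (h : contraction A B = contraction A' B') (C : Fin N → Fin N → Fin N → ℂ) :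
    tprod3 A B C = tprod3 A' B' C := by
  ext i j k
  rw [tprod3_apply, tprod3_apply, h]

/-- this ternary product of three-dimensional matrices is associative
of the second kind. -/
theorem tprod_assoc_second_kind {N : ℕ} (hN : 0 < N)
    (A B C D F : Fin N → Fin N → Fin N → ℂ) :
    tprod3 (tprod3 A B C) D F = tprod3 A (tprod3 D C B) F ∧
    tprod3 A (tprod3 D C B) F = tprod3 A B (tprod3 C D F) := by
  refine ⟨tprod3_eq_of_contraction_eq ?_ F, ?_⟩
  · rw [contraction_tprod3_left, contraction_tprod3_right]
  · ext i j k
    simp only [tprod3_apply, contraction_tprod3_right, Matrix.mul_apply, Finset.sum_mul,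
      Finset.mul_sum, mul_assoc]
    exact sum_comm
end

section
/- Let L be a two-dimensional complex vector space and let (x,y,z) ↦ [x,y,z] be any trilinear ternary bracket on L satisfying the cyclic ω-symmetry [x,y,z] = ω·[y,z,x] for all x, y, z in L. Then the basic identity holds automatically: for all x, y, z, u, v in L, the sum, over the five cyclic shifts of the quintuple (x,y,z,u,v), of [[x,y,z],u,v] + [[x,u,y],v,z] + [[x,v,u],z,y] + [[x,z,v],y,u], equals zero. -/
/-- The primitive cube root of unity `ω = exp(2πi/3)`. -/
noncomputable def ω : ℂ := Complex.exp (2 * Real.pi * Complex.I / 3)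

/-- One group of four double ternary brackets in the basic identity. -/
def bid {L : Type*} [AddCommGroup L] [Module ℂ L]
    (br : L → L → L → L) (x y z u v : L) : L :=
  br (br x y z) u v + br (br x u y) v z + br (br x v u) z y + br (br x z v) y u

/-- The number `ω` is a root of the third cyclotomic polynomial. -/
theorem omega_sq_add_omega_add_one : ω ^ 2 + ω + 1 = 0 := by
  have h : IsPrimitiveRoot ω 3 := Complex.isPrimitiveRoot_exp 3 (by norm_num)
  have := h.geom_sum_eq_zero (by norm_num)
  simp only [Finset.sum_range_succ, Finset.sum_range_zero, pow_zero, pow_one] at this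
  linear_combination this

/-- The determinant of two vectors with respect to a basis indexed by `Fin 2`. -/
noncomputable def basisDet {L : Type*} [AddCommGroup L] [Module ℂ L]
    (b : Module.Basis (Fin 2) ℂ L) (x y : L) : ℂ :=
  b.repr x 0 * b.repr y 1 - b.repr x 1 * b.repr y 0

/-- A trilinear bracket with the cyclic `ω`-symmetry on a two-dimensional space is determined by
the determinant and a linear endomorphism. -/
theorem exists_bracket_eq_det_smul_sub {L : Type*} [AddCommGroup L] [Module ℂ L]
    (b : Module.Basis (Fin 2) ℂ L) (br : L →ₗ[ℂ] L →ₗ[ℂ] L →ₗ[ℂ] L)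
    (hcyc : ∀ x y z : L, br x y z = ω • br y z x) :
    ∃ σ : L →ₗ[ℂ] L, ∀ x y z : L,
      br x y z = basisDet b y z • σ x - (ω * basisDet b x y) • σ z := by
  have hω := omega_sq_add_omega_add_one
  have hne : (1 : ℂ) - ω ≠ 0 := by
    intro h
    have : (3 : ℂ) = 0 := by linear_combination hω + (ω + 2) * h
    norm_num at this
  have hdiag (x : L) : br x x x = 0 := by
    have h : (1 - ω) • br x x x = 0 := by
      rw [sub_smul, one_smul, ← hcyc, sub_self]
    exact (smul_eq_zero.mp h).resolve_left hne
  have hlast (x y : L) : br y x x = ω • br x x y := hcyc y x x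
  have hmid (x y : L) : br x y x = (-1 - ω) • br x x y := by
    rw [hcyc, hlast, smul_smul]
    congr 1
    linear_combination hω
  refine ⟨b.constr ℂ ![br (b 0) (b 0) (b 1), -br (b 1) (b 1) (b 0)], fun x y z => ?_⟩
  have hσ (x : L) : b.constr ℂ ![br (b 0) (b 0) (b 1), -br (b 1) (b 1) (b 0)] x =
      b.repr x 0 • br (b 0) (b 0) (b 1) - b.repr x 1 • br (b 1) (b 1) (b 0) := by
    simp [Module.Basis.constr_apply_fintype, Fin.sum_univ_two, sub_eq_add_neg]
  have hexp : br x y z = br (b.repr x 0 • b 0 + b.repr x 1 • b 1)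
      (b.repr y 0 • b 0 + b.repr y 1 • b 1) (b.repr z 0 • b 0 + b.repr z 1 • b 1) := by
    have h (w : L) : b.repr w 0 • b 0 + b.repr w 1 • b 1 = w := by
      rw [← Fin.sum_univ_two fun i => b.repr w i • b i, b.sum_repr]
    rw [h, h, h]
  rw [hexp, hσ, hσ]
  simp only [map_add, map_smul, LinearMap.add_apply, LinearMap.smul_apply, hdiag,
    hmid (b 0) (b 1), hmid (b 1) (b 0), hlast (b 0) (b 1), hlast (b 1) (b 0), basisDet]
  module

/-- on a two-dimensional complex vector space, any trilinear ternary
bracket with the cyclic ω-symmetry `[x,y,z] = ω [y,z,x]` automatically satisfies the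
basic identity. -/
theorem basic_identity_of_dim_two {L : Type*} [AddCommGroup L] [Module ℂ L]
    [FiniteDimensional ℂ L] (hdim : Module.finrank ℂ L = 2)
    (br : L →ₗ[ℂ] L →ₗ[ℂ] L →ₗ[ℂ] L)
    (hcyc : ∀ x y z : L, br x y z = ω • br y z x) :
    ∀ x y z u v : L,
      bid (fun a b c => br a b c) x y z u v
        + bid (fun a b c => br a b c) y z u v x
        + bid (fun a b c => br a b c) z u v x y
        + bid (fun a b c => br a b c) u v x y z
        + bid (fun a b c => br a b c) v x y z u = 0 := by
  have b : Module.Basis (Fin 2) ℂ L := Module.finBasisOfFinrankEq ℂ L hdim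
  obtain ⟨σ, hσ⟩ := exists_bracket_eq_det_smul_sub b br hcyc
  obtain ⟨s, hcoord⟩ : ∃ s : Fin 2 → Fin 2 → ℂ, ∀ (x : L) (i : Fin 2),
      b.repr (σ x) i = b.repr x 0 * s 0 i + b.repr x 1 * s 1 i := by
    refine ⟨fun j i => b.repr (σ (b j)) i, fun x i => ?_⟩
    conv_lhs => rw [← b.sum_repr x]
    simp only [Fin.sum_univ_two, map_add, map_smul, Finsupp.add_apply, Finsupp.smul_apply,
      smul_eq_mul]
  intro x y z u v
  refine b.ext_elem fun i => ?_
  simp only [bid, hσ]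
  simp only [basisDet, map_add, map_sub, map_smul, map_zero,
    Finsupp.add_apply, Finsupp.sub_apply, Finsupp.smul_apply,
    Finsupp.zero_apply, smul_eq_mul, hcoord]
  generalize b.repr x 0 = x₀, b.repr x 1 = x₁, b.repr y 0 = y₀, b.repr y 1 = y₁,
    b.repr z 0 = z₀, b.repr z 1 = z₁, b.repr u 0 = u₀, b.repr u 1 = u₁,
    b.repr v 0 = v₀, b.repr v 1 = v₁, s 0 0 = p, s 0 1 = q, s 1 0 = r, s 1 1 = t,
    s 0 i = m, s 1 i = n
  ring
end
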